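/- arXiv:1912.02440 — 2 statements merged into one kernel-verified Lean document; each statement's English description precedes it below -/
import Mathlib

section
/- The assignments Fr(a̲) = T_l(ω) - d^l, Fr(b̲) = b^l, Fr(c̲) = c^l, Fr(d̲) = d^l define a well-defined injective ℂ-algebra homomorphism Fr : 𝒪(SL(2,ℂ)) → 𝒜_ε (the quantum Frobenius map) whose image is the central subalgebra of 𝒜_ε generated by T_l(ω) - d^l, b^l, c^l and d^l. -/
noncomputable section

/-- Generators `a`, `b`, `c`, `d` of the algebra `𝒜_ε = ℒ^ε_{0,1}(sl(2))`. -/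
inductive AGen : Type
  | a | b | c | d

/-- The defining relations of `𝒜_ε = ℒ^ε_{0,1}(sl(2))`, the specialization at `q = ε`. -/
inductive AeRel (ε : ℂ) : FreeAlgebra ℂ AGen → FreeAlgebra ℂ AGen → Prop
  | ad_comm : AeRel ε (FreeAlgebra.ι ℂ AGen.a * FreeAlgebra.ι ℂ AGen.d)
      (FreeAlgebra.ι ℂ AGen.d * FreeAlgebra.ι ℂ AGen.a)
  | db : AeRel ε (FreeAlgebra.ι ℂ AGen.d * FreeAlgebra.ι ℂ AGen.b)
      ((ε ^ 2) • (FreeAlgebra.ι ℂ AGen.b * FreeAlgebra.ι ℂ AGen.d))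
  | cd : AeRel ε (FreeAlgebra.ι ℂ AGen.c * FreeAlgebra.ι ℂ AGen.d)
      ((ε ^ 2) • (FreeAlgebra.ι ℂ AGen.d * FreeAlgebra.ι ℂ AGen.c))
  | ab : AeRel ε (FreeAlgebra.ι ℂ AGen.a * FreeAlgebra.ι ℂ AGen.b
        - FreeAlgebra.ι ℂ AGen.b * FreeAlgebra.ι ℂ AGen.a)
      ((-(1 - ε⁻¹ ^ 2)) • (FreeAlgebra.ι ℂ AGen.b * FreeAlgebra.ι ℂ AGen.d))
  | cb : AeRel ε (FreeAlgebra.ι ℂ AGen.c * FreeAlgebra.ι ℂ AGen.b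
        - FreeAlgebra.ι ℂ AGen.b * FreeAlgebra.ι ℂ AGen.c)
      ((1 - ε⁻¹ ^ 2) • (FreeAlgebra.ι ℂ AGen.d * FreeAlgebra.ι ℂ AGen.a
        - FreeAlgebra.ι ℂ AGen.d * FreeAlgebra.ι ℂ AGen.d))
  | ac : AeRel ε (FreeAlgebra.ι ℂ AGen.a * FreeAlgebra.ι ℂ AGen.c
        - FreeAlgebra.ι ℂ AGen.c * FreeAlgebra.ι ℂ AGen.a)
      ((1 - ε⁻¹ ^ 2) • (FreeAlgebra.ι ℂ AGen.d * FreeAlgebra.ι ℂ AGen.c))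
  | det : AeRel ε (FreeAlgebra.ι ℂ AGen.a * FreeAlgebra.ι ℂ AGen.d
        - (ε ^ 2) • (FreeAlgebra.ι ℂ AGen.b * FreeAlgebra.ι ℂ AGen.c)) 1

/-- The algebra `𝒜_ε = ℒ^ε_{0,1}(sl(2))`, presented by generators and relations. -/
abbrev Ae (ε : ℂ) : Type := RingQuot (AeRel ε)

noncomputable def aE (ε : ℂ) : Ae ε := RingQuot.mkAlgHom ℂ (AeRel ε) (FreeAlgebra.ι ℂ AGen.a)
noncomputable def bE (ε : ℂ) : Ae ε := RingQuot.mkAlgHom ℂ (AeRel ε) (FreeAlgebra.ι ℂ AGen.b)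
noncomputable def cE (ε : ℂ) : Ae ε := RingQuot.mkAlgHom ℂ (AeRel ε) (FreeAlgebra.ι ℂ AGen.c)
noncomputable def dE (ε : ℂ) : Ae ε := RingQuot.mkAlgHom ℂ (AeRel ε) (FreeAlgebra.ι ℂ AGen.d)

/-- The element `ω = ε a + ε⁻¹ d`. -/
noncomputable def ωE (ε : ℂ) : Ae ε := ε • aE ε + ε⁻¹ • dE ε

/-- The normalized Chebyshev polynomials: `T 0 = 2`, `T 1 = X`,
`T (k+2) = X * T (k+1) - T k`. -/
noncomputable def Tpol : ℕ → Polynomial ℂ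
  | 0 => 2
  | 1 => Polynomial.X
  | k + 2 => Polynomial.X * Tpol (k + 1) - Tpol k

/-- The defining relation `a̲ d̲ - b̲ c̲ - 1` of `𝒪(SL(2,ℂ))`, with
`a̲ = X 0`, `b̲ = X 1`, `c̲ = X 2`, `d̲ = X 3`. -/
noncomputable def relSL2 : MvPolynomial (Fin 4) ℂ :=
  MvPolynomial.X 0 * MvPolynomial.X 3 - MvPolynomial.X 1 * MvPolynomial.X 2 - 1

/-- The coordinate ring `𝒪(SL(2,ℂ)) = ℂ[a̲, b̲, c̲, d̲]/(a̲ d̲ - b̲ c̲ - 1)`. -/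
abbrev OSL2 : Type := MvPolynomial (Fin 4) ℂ ⧸ Ideal.span {relSL2}

open Polynomial in
theorem eval_Tpol_add_inv (u : ℂ) (hu : u ≠ 0) :
    ∀ n, (Tpol n).eval (u + u⁻¹) = u ^ n + u⁻¹ ^ n
  | 0 => by simp [Tpol]; norm_num
  | 1 => by simp [Tpol]
  | n + 2 => by
    have h : u * u⁻¹ = 1 := mul_inv_cancel₀ hu
    simp only [Tpol, eval_sub, eval_mul, eval_X, eval_Tpol_add_inv u hu (n + 1),
      eval_Tpol_add_inv u hu n]
    linear_combination (u ^ n + u⁻¹ ^ n) * h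

theorem exists_add_inv_eq (w : ℂ) : ∃ u : ℂ, u ≠ 0 ∧ w = u + u⁻¹ := by
  obtain ⟨s, hs⟩ := IsAlgClosed.exists_pow_nat_eq (w ^ 2 - 4) (n := 2) (by norm_num)
  have h : (w + s) / 2 * ((w - s) / 2) = 1 := by linear_combination -hs / 4
  refine ⟨(w + s) / 2, left_ne_zero_of_mul_eq_one h, ?_⟩
  rw [inv_eq_of_mul_eq_one_right h]
  ring

theorem exists_eval_Tpol_eq {n : ℕ} (hn : 0 < n) (z : ℂ) : ∃ w, (Tpol n).eval w = z := by
  obtain ⟨v, hv, rfl⟩ := exists_add_inv_eq z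
  obtain ⟨u, rfl⟩ := IsAlgClosed.exists_pow_nat_eq v hn
  have hu : u ≠ 0 := by
    rintro rfl
    exact hv (zero_pow hn.ne')
  exact ⟨u + u⁻¹, by rw [eval_Tpol_add_inv u hu, inv_pow]⟩

theorem IsPrimitiveRoot.prod_range_sub_pow_mul {l : ℕ} {η : ℂ} (hη : IsPrimitiveRoot η l)
    (hl : 0 < l) (x v : ℂ) :
    ∏ k ∈ Finset.range l, (v - η ^ (k + 1) * x) = v ^ l - x ^ l := by
  have : NeZero l := ⟨hl.ne'⟩
  rw [hη.pow_sub_pow_eq_prod_sub_mul v x hl]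
  refine Finset.prod_bij (fun k _ => η ^ (k + 1)) ?_ ?_ ?_ (fun _ _ => rfl)
  · intro k _
    rw [Polynomial.mem_nthRootsFinset hl, ← pow_mul, mul_comm, pow_mul, hη.pow_eq_one, one_pow]
  · intro i hi j hj hij
    refine hη.pow_inj (Finset.mem_range.1 hi) (Finset.mem_range.1 hj) ?_
    simpa [pow_succ, hη.ne_zero hl.ne'] using hij
  · intro ζ hζ
    have h1 : (ζ * η⁻¹) ^ l = 1 := by
      rw [mul_pow, (Polynomial.mem_nthRootsFinset hl _).1 hζ, inv_pow, hη.pow_eq_one]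
      simp
    obtain ⟨i, hi, h⟩ := hη.eq_pow_of_pow_eq_one h1
    refine ⟨i, Finset.mem_range.2 hi, ?_⟩
    rw [pow_succ, h, inv_mul_cancel_right₀ (hη.ne_zero hl.ne')]

theorem prod_quadratic_eq_complex {l : ℕ} (hl : 0 < l) (hodd : Odd l) {ε : ℂ}
    (hε : IsPrimitiveRoot ε l) (w x : ℂ) :
    ∏ k ∈ Finset.range l, (ε⁻¹ * (ε⁻¹ ^ 2) ^ (k + 1) * (w * x)
        - ((ε⁻¹ ^ 2) ^ (k + 1)) ^ 2 * x ^ 2 - ε⁻¹ ^ 2)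
      = (Tpol l).eval w * x ^ l - (x ^ l) ^ 2 - 1 := by
  obtain ⟨u, hu, rfl⟩ := exists_add_inv_eq w
  have hη : IsPrimitiveRoot (ε⁻¹ ^ 2) l :=
    hε.inv.pow_of_coprime 2 (Nat.coprime_two_left.2 hodd)
  have huu : u * u⁻¹ = 1 := mul_inv_cancel₀ hu
  have key : ∀ k ∈ Finset.range l, (ε⁻¹ * (ε⁻¹ ^ 2) ^ (k + 1) * ((u + u⁻¹) * x)
        - ((ε⁻¹ ^ 2) ^ (k + 1)) ^ 2 * x ^ 2 - ε⁻¹ ^ 2)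
      = (-1) * ((ε⁻¹ * u - (ε⁻¹ ^ 2) ^ (k + 1) * x) * (ε⁻¹ * u⁻¹ - (ε⁻¹ ^ 2) ^ (k + 1) * x)) := by
    intro k _
    linear_combination ε⁻¹ ^ 2 * huu
  have he : ε⁻¹ ^ l = 1 := hε.inv.pow_eq_one
  have hul : u ^ l * u⁻¹ ^ l = 1 := by rw [← mul_pow, huu, one_pow]
  rw [Finset.prod_congr rfl key, Finset.prod_mul_distrib, Finset.prod_mul_distrib,
    hη.prod_range_sub_pow_mul hl, hη.prod_range_sub_pow_mul hl, Finset.prod_const,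
    Finset.card_range, hodd.neg_one_pow, eval_Tpol_add_inv u hu, mul_pow, mul_pow, he]
  linear_combination -hul

theorem prod_quadratic_eq {l : ℕ} (hl : 0 < l) (hodd : Odd l) {ε : ℂ}
    (hε : IsPrimitiveRoot ε l) {R : Type*} [CommRing R] [Algebra ℂ R] (w x : R) :
    ∏ k ∈ Finset.range l, ((ε⁻¹ * (ε⁻¹ ^ 2) ^ (k + 1)) • (w * x)
        - (((ε⁻¹ ^ 2) ^ (k + 1)) ^ 2) • x ^ 2 - (ε⁻¹ ^ 2) • (1 : R))
      = Polynomial.aeval w (Tpol l) * x ^ l - (x ^ l) ^ 2 - 1 := by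
  have h : ∏ k ∈ Finset.range l, ((ε⁻¹ * (ε⁻¹ ^ 2) ^ (k + 1)) •
        ((MvPolynomial.X 0 : MvPolynomial (Fin 2) ℂ) * MvPolynomial.X 1)
        - (((ε⁻¹ ^ 2) ^ (k + 1)) ^ 2) • (MvPolynomial.X 1) ^ 2 - (ε⁻¹ ^ 2) • 1)
      = Polynomial.aeval (MvPolynomial.X 0) (Tpol l) * (MvPolynomial.X 1) ^ l
        - ((MvPolynomial.X 1) ^ l) ^ 2 - 1 := by
    refine MvPolynomial.funext fun p => ?_
    have hT : MvPolynomial.eval p (Polynomial.aeval (MvPolynomial.X 0) (Tpol l))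
        = (Tpol l).eval (p 0) := by
      rw [← MvPolynomial.coe_aeval_eq_eval, RingHom.coe_coe, ← Polynomial.aeval_algHom_apply,
        MvPolynomial.aeval_X, Polynomial.coe_aeval_eq_eval]
    have := prod_quadratic_eq_complex hl hodd hε (p 0) (p 1)
    simp only [map_prod, map_sub, map_mul, map_pow, MvPolynomial.smul_eval, MvPolynomial.eval_X,
      map_one, hT]
    simpa using this
  have h2 := congrArg (MvPolynomial.aeval ![w, x]) h
  simpa [map_prod, ← Polynomial.aeval_algHom_apply] using h2

namespace Ae

variable {ε : ℂ}

theorem a_mul_d : aE ε * dE ε = dE ε * aE ε := by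
  simpa [aE, dE] using RingQuot.mkAlgHom_rel ℂ (AeRel.ad_comm (ε := ε))

theorem d_mul_b : dE ε * bE ε = ε ^ 2 • (bE ε * dE ε) := by
  simpa [bE, dE] using RingQuot.mkAlgHom_rel ℂ (AeRel.db (ε := ε))

theorem c_mul_d : cE ε * dE ε = ε ^ 2 • (dE ε * cE ε) := by
  simpa [cE, dE] using RingQuot.mkAlgHom_rel ℂ (AeRel.cd (ε := ε))

theorem a_mul_b_sub : aE ε * bE ε - bE ε * aE ε = (-(1 - ε⁻¹ ^ 2)) • (bE ε * dE ε) := by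
  simpa only [map_sub, map_mul, map_smul, aE, bE, dE]
    using RingQuot.mkAlgHom_rel ℂ (AeRel.ab (ε := ε))

theorem c_mul_b_sub :
    cE ε * bE ε - bE ε * cE ε = (1 - ε⁻¹ ^ 2) • (dE ε * aE ε - dE ε * dE ε) := by
  simpa only [map_sub, map_mul, map_smul, aE, bE, cE, dE]
    using RingQuot.mkAlgHom_rel ℂ (AeRel.cb (ε := ε))

theorem a_mul_c_sub : aE ε * cE ε - cE ε * aE ε = (1 - ε⁻¹ ^ 2) • (dE ε * cE ε) := by
  simpa only [map_sub, map_mul, map_smul, aE, cE, dE]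
    using RingQuot.mkAlgHom_rel ℂ (AeRel.ac (ε := ε))

theorem a_mul_d_sub : aE ε * dE ε - ε ^ 2 • (bE ε * cE ε) = 1 := by
  simpa only [map_sub, map_mul, map_smul, map_one, aE, bE, cE, dE]
    using RingQuot.mkAlgHom_rel ℂ (AeRel.det (ε := ε))

theorem mem_center_of_comm_generators {z : Ae ε} (ha : Commute z (aE ε)) (hb : Commute z (bE ε))
    (hc : Commute z (cE ε)) (hd : Commute z (dE ε)) : z ∈ Subalgebra.center ℂ (Ae ε) := by
  rw [Subalgebra.mem_center_iff]
  intro y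
  obtain ⟨y, rfl⟩ := RingQuot.mkAlgHom_surjective ℂ (AeRel ε) y
  suffices h : Commute z (RingQuot.mkAlgHom ℂ (AeRel ε) y) from h.eq.symm
  induction y using FreeAlgebra.induction with
  | grade0 r => rw [AlgHom.commutes]; exact (Algebra.commutes r z).symm
  | grade1 g => cases g <;> assumption
  | mul x y hx hy => rw [map_mul]; exact hx.mul_right hy
  | add x y hx hy => rw [map_add]; exact hx.add_right hy

theorem b_mul_d (h0 : ε ≠ 0) : bE ε * dE ε = ε⁻¹ ^ 2 • (dE ε * bE ε) := by
  rw [d_mul_b, smul_smul, ← mul_pow, inv_mul_cancel₀ h0, one_pow, one_smul]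

theorem omega_comm_d : Commute (ωE ε) (dE ε) :=
  (Commute.smul_left a_mul_d _).add_left (Commute.smul_left (Commute.refl _) _)

theorem omega_comm_b (h0 : ε ≠ 0) : Commute (ωE ε) (bE ε) := by
  have h := eq_add_of_sub_eq (a_mul_b_sub (ε := ε))
  rw [commute_iff_eq, ωE, add_mul, mul_add]
  simp only [smul_mul_assoc, mul_smul_comm, h, d_mul_b]
  match_scalars
  · field_simp
    ring
  · ring

theorem omega_comm_c (h0 : ε ≠ 0) : Commute (ωE ε) (cE ε) := by
  have h := eq_add_of_sub_eq (a_mul_c_sub (ε := ε))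
  rw [commute_iff_eq, ωE, add_mul, mul_add]
  simp only [smul_mul_assoc, mul_smul_comm, h, c_mul_d]
  match_scalars
  · field_simp
    ring
  · ring

theorem a_eq (h0 : ε ≠ 0) : aE ε = ε⁻¹ • ωE ε - ε⁻¹ ^ 2 • dE ε := by
  rw [ωE]
  match_scalars
  · field_simp
  · ring

theorem mem_center_of_comm (h0 : ε ≠ 0) {z : Ae ε} (hw : Commute z (ωE ε))
    (hb : Commute z (bE ε)) (hc : Commute z (cE ε)) (hd : Commute z (dE ε)) :
    z ∈ Subalgebra.center ℂ (Ae ε) := by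
  refine mem_center_of_comm_generators ?_ hb hc hd
  rw [a_eq h0]
  exact (hw.smul_right _).sub_right (hd.smul_right _)

theorem omega_mem_center (h0 : ε ≠ 0) : ωE ε ∈ Subalgebra.center ℂ (Ae ε) :=
  mem_center_of_comm h0 (Commute.refl _) (omega_comm_b h0) (omega_comm_c h0) omega_comm_d

/-- The quadratic polynomial in `d` over `ℂ[ω]` that equals `c b` at `s = 1` and `b c` at
`s = ε⁻²`. -/
def quad (ε s : ℂ) : Ae ε :=
  (ε⁻¹ * s) • (ωE ε * dE ε) - s ^ 2 • dE ε ^ 2 - ε⁻¹ ^ 2 • (1 : Ae ε)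

theorem b_mul_c (h0 : ε ≠ 0) : bE ε * cE ε = quad ε (ε⁻¹ ^ 2) := by
  have h : bE ε * cE ε = ε⁻¹ ^ 2 • (aE ε * dE ε - 1) := by
    rw [← a_mul_d_sub (ε := ε), sub_sub_cancel, smul_smul, ← mul_pow, inv_mul_cancel₀ h0,
      one_pow, one_smul]
  rw [h, a_eq h0, quad, sub_mul, smul_mul_assoc, smul_mul_assoc, ← sq]
  match_scalars <;> ring

theorem c_mul_b (h0 : ε ≠ 0) : cE ε * bE ε = quad ε 1 := by
  rw [eq_add_of_sub_eq (c_mul_b_sub (ε := ε)), b_mul_c h0, ← a_mul_d, a_eq h0, quad, quad, sub_mul,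
    smul_mul_assoc, smul_mul_assoc, ← sq]
  match_scalars <;> ring

theorem mul_quad {y : Ae ε} {t : ℂ} (hw : Commute (ωE ε) y) (hd : y * dE ε = t • (dE ε * y))
    (s : ℂ) : y * quad ε s = quad ε (s * t) * y := by
  have h1 : y * (ωE ε * dE ε) = t • (ωE ε * dE ε * y) := by
    rw [← mul_assoc, ← hw.eq, mul_assoc, hd, mul_smul_comm, mul_assoc]
  have h2 : y * dE ε ^ 2 = t ^ 2 • (dE ε ^ 2 * y) := by
    rw [sq, ← mul_assoc, hd, smul_mul_assoc, mul_assoc, hd, mul_smul_comm, smul_smul, ← mul_assoc,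
      sq]
  rw [quad, quad, mul_sub, mul_sub, sub_mul, sub_mul]
  simp only [smul_mul_assoc, mul_smul_comm, h1, h2, mul_one, one_mul]
  match_scalars <;> ring

theorem pow_mul_of_mul_eq_smul {A : Type*} [Ring A] [Algebra ℂ A] {y x : A} {t : ℂ}
    (h : y * x = t • (x * y)) (n : ℕ) : y ^ n * x = t ^ n • (x * y ^ n) := by
  induction n with
  | zero => simp
  | succ n ih =>
    rw [pow_succ', mul_assoc, ih, mul_smul_comm, ← mul_assoc, h, smul_mul_assoc, smul_smul,
      ← pow_succ, mul_assoc]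

theorem b_pow_mul_quad (h0 : ε ≠ 0) (n : ℕ) (s : ℂ) :
    bE ε ^ n * quad ε s = quad ε (s * (ε⁻¹ ^ 2) ^ n) * bE ε ^ n :=
  mul_quad ((omega_comm_b h0).pow_right n) (pow_mul_of_mul_eq_smul (b_mul_d h0) n) s

theorem c_pow_mul_quad (h0 : ε ≠ 0) (n : ℕ) (s : ℂ) :
    cE ε ^ n * quad ε s = quad ε (s * (ε ^ 2) ^ n) * cE ε ^ n :=
  mul_quad ((omega_comm_c h0).pow_right n) (pow_mul_of_mul_eq_smul c_mul_d n) s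

theorem b_pow_succ_mul_c (h0 : ε ≠ 0) (n : ℕ) :
    bE ε ^ (n + 1) * cE ε = quad ε ((ε⁻¹ ^ 2) ^ (n + 1)) * bE ε ^ n := by
  rw [pow_succ, mul_assoc, b_mul_c h0, b_pow_mul_quad h0, ← pow_succ']

theorem c_pow_succ_mul_b (h0 : ε ≠ 0) (n : ℕ) :
    cE ε ^ (n + 1) * bE ε = quad ε ((ε ^ 2) ^ n) * cE ε ^ n := by
  rw [pow_succ, mul_assoc, c_mul_b h0, c_pow_mul_quad h0, one_mul]

section RootOfUnity

variable {l : ℕ}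

theorem b_pow_comm_d (h0 : ε ≠ 0) (hε : ε ^ l = 1) : Commute (bE ε ^ l) (dE ε) := by
  rw [commute_iff_eq, pow_mul_of_mul_eq_smul (b_mul_d h0), ← pow_mul, mul_comm 2, pow_mul, inv_pow,
    hε, inv_one, one_pow, one_smul]

theorem c_pow_comm_d (hε : ε ^ l = 1) : Commute (cE ε ^ l) (dE ε) := by
  rw [commute_iff_eq, pow_mul_of_mul_eq_smul c_mul_d, ← pow_mul, mul_comm 2, pow_mul, hε, one_pow,
    one_smul]

theorem d_pow_comm_b (hε : ε ^ l = 1) : Commute (dE ε ^ l) (bE ε) := by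
  rw [commute_iff_eq, pow_mul_of_mul_eq_smul d_mul_b, ← pow_mul, mul_comm 2, pow_mul, hε, one_pow,
    one_smul]

theorem d_pow_comm_c (h0 : ε ≠ 0) (hε : ε ^ l = 1) : Commute (dE ε ^ l) (cE ε) := by
  have h : dE ε * cE ε = ε⁻¹ ^ 2 • (cE ε * dE ε) := by
    rw [c_mul_d, smul_smul, ← mul_pow, inv_mul_cancel₀ h0, one_pow, one_smul]
  rw [commute_iff_eq, pow_mul_of_mul_eq_smul h, ← pow_mul, mul_comm 2, pow_mul, inv_pow, hε,
    inv_one, one_pow, one_smul]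

theorem b_pow_comm_c (h0 : ε ≠ 0) (hε : ε ^ l = 1) : Commute (bE ε ^ l) (cE ε) := by
  rw [commute_iff_eq]
  cases l with
  | zero => simp
  | succ n =>
    rw [b_pow_succ_mul_c h0, ← pow_mul, mul_comm 2, pow_mul, inv_pow, hε, inv_one, one_pow,
      ← c_mul_b h0, mul_assoc, ← pow_succ']

theorem c_pow_comm_b (h0 : ε ≠ 0) (hε : ε ^ l = 1) : Commute (cE ε ^ l) (bE ε) := by
  rw [commute_iff_eq]
  cases l with
  | zero => simp
  | succ n =>
    have h : (ε ^ 2) ^ n = ε⁻¹ ^ 2 := by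
      rw [inv_pow, ← pow_mul, mul_comm, pow_mul]
      refine eq_inv_of_mul_eq_one_left ?_
      rw [← mul_pow, ← pow_succ, hε, one_pow]
    rw [c_pow_succ_mul_b h0, h, ← b_mul_c h0, mul_assoc, ← pow_succ']

theorem b_pow_mem_center (h0 : ε ≠ 0) (hε : ε ^ l = 1) :
    bE ε ^ l ∈ Subalgebra.center ℂ (Ae ε) :=
  mem_center_of_comm h0 ((omega_comm_b h0).symm.pow_left l) (.pow_left (.refl _) l)
    (b_pow_comm_c h0 hε) (b_pow_comm_d h0 hε)

theorem c_pow_mem_center (h0 : ε ≠ 0) (hε : ε ^ l = 1) :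
    cE ε ^ l ∈ Subalgebra.center ℂ (Ae ε) :=
  mem_center_of_comm h0 ((omega_comm_c h0).symm.pow_left l) (c_pow_comm_b h0 hε)
    (.pow_left (.refl _) l) (c_pow_comm_d hε)

theorem d_pow_mem_center (h0 : ε ≠ 0) (hε : ε ^ l = 1) :
    dE ε ^ l ∈ Subalgebra.center ℂ (Ae ε) :=
  mem_center_of_comm h0 (omega_comm_d.symm.pow_left l) (d_pow_comm_b hε)
    (d_pow_comm_c h0 hε) (.pow_left (.refl _) l)

end RootOfUnity

theorem aeval_omega_mem_center (h0 : ε ≠ 0) (p : Polynomial ℂ) :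
    Polynomial.aeval (ωE ε) p ∈ Subalgebra.center ℂ (Ae ε) := by
  have h := Polynomial.aeval_algHom_apply (Subalgebra.center ℂ (Ae ε)).val
    ⟨ωE ε, omega_mem_center h0⟩ p
  rw [Subalgebra.coe_val] at h
  exact h ▸ Subtype.coe_prop _

open Polynomial in
theorem b_pow_mul_c_pow {l : ℕ} (hl : 0 < l) (hodd : Odd l) (hε : IsPrimitiveRoot ε l) :
    bE ε ^ l * cE ε ^ l = aeval (ωE ε) (Tpol l) * dE ε ^ l - (dE ε ^ l) ^ 2 - 1 := by
  have h0 : ε ≠ 0 := hε.ne_zero hl.ne'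
  let ψ : ℂ[X] →+* Ae ε := (aeval (ωE ε)).toRingHom
  let φ : ℂ[X][X] →ₐ[ℂ] Ae ε :=
    { eval₂RingHom' ψ (dE ε) fun p =>
        (Subalgebra.mem_center_iff.1 (aeval_omega_mem_center h0 p) (dE ε)).symm with
      commutes' := fun r => (eval₂_C ψ (dE ε)).trans (aeval_C _ r) }
  have hX : φ X = dE ε := eval₂_X _ _
  have hw : φ (C X) = ωE ε := (eval₂_C _ _).trans (aeval_X _)
  have key : ∀ n : ℕ, bE ε ^ n * cE ε ^ n = φ (∏ k ∈ Finset.range n,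
      ((ε⁻¹ * (ε⁻¹ ^ 2) ^ (k + 1)) • (C X * X)
        - (((ε⁻¹ ^ 2) ^ (k + 1)) ^ 2) • X ^ 2 - (ε⁻¹ ^ 2) • (1 : ℂ[X][X]))) := by
    intro n
    induction n with
    | zero => simp
    | succ n ih =>
      rw [Finset.prod_range_succ, mul_comm, map_mul, ← ih, pow_succ' (cE ε), ← mul_assoc,
        b_pow_succ_mul_c h0, mul_assoc, quad]
      simp only [map_sub, map_smul, map_mul, map_pow, map_one, hX, hw]
  rw [key, prod_quadratic_eq hl hodd hε]
  simp only [map_sub, map_mul, map_pow, map_one, hX, ← aeval_algHom_apply, hw]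

section Representation

/-- The operator `v ↦ (i ↦ f i * v (i + m))` on complex sequences indexed by `ℤ`. -/
def weightedShift (f : ℤ → ℂ) (m : ℤ) : Module.End ℂ (ℤ → ℂ) where
  toFun v i := f i * v (i + m)
  map_add' u v := by ext i; simp [mul_add]
  map_smul' r v := by ext i; simp [mul_left_comm]

theorem weightedShift_apply (f : ℤ → ℂ) (m : ℤ) (v : ℤ → ℂ) (i : ℤ) :
    weightedShift f m v i = f i * v (i + m) := rfl

/-- Images of the generators under the representation with `b` invertible and `ω` scalar. -/
def shiftGen (ε w β δ : ℂ) : AGen → Module.End ℂ (ℤ → ℂ)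
  | .a => weightedShift (fun i => ε⁻¹ * w - ε⁻¹ ^ 2 * (δ * ε ^ (2 * i))) 0
  | .b => weightedShift (fun _ => β) (-1)
  | .c => weightedShift (fun i =>
      β⁻¹ * (ε⁻¹ * w * (δ * ε ^ (2 * i)) - (δ * ε ^ (2 * i)) ^ 2 - ε⁻¹ ^ 2)) 1
  | .d => weightedShift (fun i => δ * ε ^ (2 * i)) 0

theorem shiftGen_rel (h0 : ε ≠ 0) (w : ℂ) {β : ℂ} (hβ : β ≠ 0) (δ : ℂ)
    ⦃x y : FreeAlgebra ℂ AGen⦄ (h : AeRel ε x y) :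
    FreeAlgebra.lift ℂ (shiftGen ε w β δ) x = FreeAlgebra.lift ℂ (shiftGen ε w β δ) y := by
  have hp : ∀ i : ℤ, ε ^ (2 * (i + 1)) = ε ^ (2 * i) * ε ^ 2 := fun i => by
    rw [mul_add, zpow_add₀ h0]; rfl
  have hm : ∀ i : ℤ, ε ^ (2 * (i + -1)) = ε ^ (2 * i) * ε⁻¹ ^ 2 := fun i => by
    rw [mul_add, zpow_add₀ h0, inv_pow]; rfl
  cases h <;>
  · ext v i
    simp only [map_sub, map_mul, map_smul, map_one, FreeAlgebra.lift_ι_apply, shiftGen,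
      LinearMap.sub_apply, Module.End.mul_apply, LinearMap.smul_apply, Module.End.one_apply,
      Pi.sub_apply, Pi.smul_apply, weightedShift_apply, smul_eq_mul, hp, hm, add_zero,
      neg_add_cancel_right, add_neg_cancel_right]
    field_simp
    try ring

/-- The representation of `𝒜_ε` on complex sequences with `b` invertible and `ω` scalar. -/
def shiftRep (h0 : ε ≠ 0) (w : ℂ) {β : ℂ} (hβ : β ≠ 0) (δ : ℂ) :
    Ae ε →ₐ[ℂ] Module.End ℂ (ℤ → ℂ) :=
  RingQuot.liftAlgHom ℂ ⟨FreeAlgebra.lift ℂ (shiftGen ε w β δ), shiftGen_rel h0 w hβ δ⟩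

variable (h0 : ε ≠ 0) (w : ℂ) {β : ℂ} (hβ : β ≠ 0) (δ : ℂ)

theorem shiftRep_mkAlgHom (g : AGen) :
    shiftRep h0 w hβ δ (RingQuot.mkAlgHom ℂ (AeRel ε) (FreeAlgebra.ι ℂ g))
      = shiftGen ε w β δ g := by
  rw [shiftRep, RingQuot.liftAlgHom_mkAlgHom_apply, FreeAlgebra.lift_ι_apply]

theorem shiftRep_omega : shiftRep h0 w hβ δ (ωE ε) = algebraMap ℂ _ w := by
  rw [ωE, map_add, map_smul, map_smul, aE, dE, shiftRep_mkAlgHom, shiftRep_mkAlgHom]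
  ext v i
  simp only [shiftGen, LinearMap.add_apply, LinearMap.smul_apply, Pi.add_apply, Pi.smul_apply,
    weightedShift_apply, smul_eq_mul, add_zero, Module.algebraMap_end_apply]
  field_simp
  ring

theorem shiftRep_b_pow_one (n : ℕ) :
    shiftRep h0 w hβ δ (bE ε ^ n) (1 : ℤ → ℂ) = β ^ n • 1 := by
  have h : shiftRep h0 w hβ δ (bE ε) (1 : ℤ → ℂ) = β • 1 := by
    rw [bE, shiftRep_mkAlgHom]
    ext i
    simp [shiftGen, weightedShift_apply]
  induction n with
  | zero => simp
  | succ n ih => rw [pow_succ, map_mul, Module.End.mul_apply, h, map_smul, ih, smul_smul, pow_succ']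

theorem shiftRep_d_pow_one {l : ℕ} (hε : ε ^ l = 1) :
    shiftRep h0 w hβ δ (dE ε ^ l) (1 : ℤ → ℂ) = δ ^ l • 1 := by
  have h : ∀ n i, (shiftRep h0 w hβ δ (dE ε ^ n) (1 : ℤ → ℂ)) i = (δ * ε ^ (2 * i)) ^ n := by
    intro n
    induction n with
    | zero => simp
    | succ n ih =>
      intro i
      rw [pow_succ', map_mul, Module.End.mul_apply, dE, shiftRep_mkAlgHom, shiftGen,
        weightedShift_apply, add_zero, ← dE, ih, pow_succ']
  ext i
  rw [h, mul_pow, ← zpow_natCast (ε ^ (2 * i)), zpow_comm, zpow_natCast, hε, one_zpow]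
  simp

end Representation

end Ae

namespace OSL2

/-- The coordinate functions on `SL(2,ℂ)`. -/
def coord (i : Fin 4) : OSL2 := Ideal.Quotient.mk (Ideal.span {relSL2}) (MvPolynomial.X i)

theorem coord_rel : coord 0 * coord 3 - coord 1 * coord 2 = 1 := by
  rw [← sub_eq_zero]
  exact Ideal.Quotient.eq_zero_iff_mem.2 (Ideal.mem_span_singleton_self relSL2)

theorem coord_one_mul_eq_zero {f : OSL2} (h : coord 1 * f = 0) : f = 0 := by
  obtain ⟨f, rfl⟩ := Ideal.Quotient.mk_surjective f
  rw [coord, ← map_mul, Ideal.Quotient.eq_zero_iff_mem, Ideal.mem_span_singleton] at h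
  rw [Ideal.Quotient.eq_zero_iff_mem, Ideal.mem_span_singleton]
  obtain ⟨g, hg⟩ := h
  have hX : ¬ (MvPolynomial.X 1 : MvPolynomial (Fin 4) ℂ) ∣ relSL2 := by
    rintro ⟨k, hk⟩
    have := congrArg (MvPolynomial.eval 0) hk
    simp [relSL2] at this
  obtain ⟨k, rfl⟩ :=
    ((MvPolynomial.X_prime (i := (1 : Fin 4))).dvd_or_dvd (Dvd.intro _ hg)).resolve_left hX
  refine ⟨k, mul_left_cancel₀ (MvPolynomial.X_ne_zero (1 : Fin 4)) ?_⟩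
  rw [hg, mul_left_comm]

theorem coord_one_pow_mul_eq_zero {f : OSL2} (n : ℕ) (h : coord 1 ^ n * f = 0) : f = 0 := by
  induction n with
  | zero => simpa using h
  | succ n ih => exact ih (coord_one_mul_eq_zero (by rwa [← mul_assoc, ← pow_succ']))

theorem exists_coord_one_pow_mul_eq (f : OSL2) : ∃ (n : ℕ) (g : MvPolynomial (Fin 3) ℂ),
    coord 1 ^ n * f = MvPolynomial.aeval ![coord 0, coord 1, coord 3] g := by
  obtain ⟨f, rfl⟩ := Ideal.Quotient.mk_surjective f
  induction f using MvPolynomial.induction_on with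
  | C r => exact ⟨0, MvPolynomial.C r, by simp; rfl⟩
  | add p q hp hq =>
    obtain ⟨n, g, hg⟩ := hp
    obtain ⟨m, k, hk⟩ := hq
    refine ⟨n + m, MvPolynomial.X 1 ^ m * g + MvPolynomial.X 1 ^ n * k, ?_⟩
    rw [map_add, map_add, map_mul, map_mul, ← hg, ← hk]
    simp only [map_pow, MvPolynomial.aeval_X, Matrix.cons_val]
    ring
  | mul_X p i hp =>
    obtain ⟨n, g, hg⟩ := hp
    rw [map_mul, ← coord]
    have h (j : Fin 3) (hj : ![coord 0, coord 1, coord 3] j = coord i) : ∃ (n : ℕ)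
        (g : MvPolynomial (Fin 3) ℂ), coord 1 ^ n * (Ideal.Quotient.mk _ p * coord i)
          = MvPolynomial.aeval ![coord 0, coord 1, coord 3] g :=
      ⟨n, g * MvPolynomial.X j, by rw [map_mul, ← hg, MvPolynomial.aeval_X, hj, mul_assoc]⟩
    fin_cases i
    · exact h 0 rfl
    · exact h 1 rfl
    · refine ⟨n + 1, g * (MvPolynomial.X 0 * MvPolynomial.X 2 - 1), ?_⟩
      rw [map_mul, ← hg]
      simp only [map_sub, map_mul, map_one, MvPolynomial.aeval_X, Matrix.cons_val]
      rw [← coord_rel]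
      simp only [Fin.reduceFinMk]
      ring
    · exact h 2 rfl

end OSL2

theorem MvPolynomial.aeval_apply_of_eigenvector {σ V : Type*} [AddCommGroup V] [Module ℂ V]
    {A : Type*} [CommRing A] [Algebra ℂ A] (ρ : A →ₐ[ℂ] Module.End ℂ V) (x : σ → A) (p : σ → ℂ)
    (v : V) (h : ∀ i, ρ (x i) v = p i • v) (g : MvPolynomial σ ℂ) :
    ρ (MvPolynomial.aeval x g) v = MvPolynomial.eval p g • v := by
  induction g using MvPolynomial.induction_on with
  | C r => simp
  | add f g hf hg => simp [hf, hg, add_smul]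
  | mul_X f i hf => simp [hf, h, smul_smul, mul_comm]

open Ae OSL2

/-- Let `l ≥ 3` be odd and `ε` a primitive `l`-th root of unity.  The assignments
`Fr(a̲) = T_l(ω) - d^l`, `Fr(b̲) = b^l`, `Fr(c̲) = c^l`, `Fr(d̲) = d^l` define a
well-defined injective `ℂ`-algebra homomorphism `Fr : 𝒪(SL(2,ℂ)) → 𝒜_ε` (the quantum
Frobenius map), whose image is the central subalgebra of `𝒜_ε` generated by
`T_l(ω) - d^l, b^l, c^l, d^l`. -/
theorem statement12 (l : ℕ) (hl : 3 ≤ l) (hodd : Odd l)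
    (ε : ℂ) (hε : IsPrimitiveRoot ε l) :
    ∃ Fr : OSL2 →ₐ[ℂ] Ae ε,
      Fr (Ideal.Quotient.mk (Ideal.span {relSL2}) (MvPolynomial.X 0))
          = Polynomial.aeval (ωE ε) (Tpol l) - dE ε ^ l
      ∧ Fr (Ideal.Quotient.mk (Ideal.span {relSL2}) (MvPolynomial.X 1)) = bE ε ^ l
      ∧ Fr (Ideal.Quotient.mk (Ideal.span {relSL2}) (MvPolynomial.X 2)) = cE ε ^ l
      ∧ Fr (Ideal.Quotient.mk (Ideal.span {relSL2}) (MvPolynomial.X 3)) = dE ε ^ l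
      ∧ Function.Injective Fr
      ∧ Fr.range = Algebra.adjoin ℂ
          ({Polynomial.aeval (ωE ε) (Tpol l) - dE ε ^ l, bE ε ^ l, cE ε ^ l, dE ε ^ l} :
            Set (Ae ε))
      ∧ Fr.range ≤ Subalgebra.center ℂ (Ae ε) := by
  have hl0 : 0 < l := by omega
  have h0 : ε ≠ 0 := hε.ne_zero hl0.ne'
  have h1 : ε ^ l = 1 := hε.pow_eq_one
  let Z := Subalgebra.center ℂ (Ae ε)
  let x : Fin 4 → Z := ![⟨Polynomial.aeval (ωE ε) (Tpol l) - dE ε ^ l,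
      sub_mem (aeval_omega_mem_center h0 _) (d_pow_mem_center h0 h1)⟩,
    ⟨bE ε ^ l, b_pow_mem_center h0 h1⟩, ⟨cE ε ^ l, c_pow_mem_center h0 h1⟩,
    ⟨dE ε ^ l, d_pow_mem_center h0 h1⟩]
  have hx : MvPolynomial.aeval x relSL2 = 0 := by
    apply Subtype.ext
    simp [relSL2, x, b_pow_mul_c_pow hl0 hodd hε, sub_mul, sq]
  let F : OSL2 →ₐ[ℂ] Z := Ideal.Quotient.liftₐ _ (MvPolynomial.aeval x) fun f hf => by
    obtain ⟨g, rfl⟩ := Ideal.mem_span_singleton.1 hf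
    rw [map_mul, hx, zero_mul]
  have hF (i : Fin 4) : F (coord i) = x i := MvPolynomial.aeval_X x i
  refine ⟨Z.val.comp F, congrArg Subtype.val (hF 0), congrArg Subtype.val (hF 1),
    congrArg Subtype.val (hF 2), congrArg Subtype.val (hF 3), ?_, ?_, ?_⟩
  · refine Subtype.val_injective.comp ((injective_iff_map_eq_zero F).2 fun f hf => ?_)
    obtain ⟨n, g, hg⟩ := exists_coord_one_pow_mul_eq f
    suffices h : g = 0 from coord_one_pow_mul_eq_zero n (by rw [hg, h, map_zero])
    refine (mul_eq_zero.1 (MvPolynomial.funext fun p => ?_ : MvPolynomial.X 1 * g = 0)).resolve_left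
      (MvPolynomial.X_ne_zero 1)
    rw [map_mul, MvPolynomial.eval_X, map_zero, mul_eq_zero, or_iff_not_imp_left]
    intro hp
    obtain ⟨β, hβ⟩ := IsAlgClosed.exists_pow_nat_eq (p 1) hl0
    obtain ⟨δ, hδ⟩ := IsAlgClosed.exists_pow_nat_eq (p 2) hl0
    obtain ⟨w, hw⟩ := exists_eval_Tpol_eq hl0 (p 0 + p 2)
    have hβ0 : β ≠ 0 := by
      rintro rfl
      exact hp (by rw [← hβ, zero_pow hl0.ne'])
    have hFg : MvPolynomial.aeval (fun i => F (![coord 0, coord 1, coord 3] i)) g = 0 := by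
      rw [← MvPolynomial.comp_aeval_apply, ← hg, map_mul, hf, mul_zero]
    have hd := shiftRep_d_pow_one h0 w hβ0 δ h1
    rw [map_pow, hδ] at hd
    have hv := MvPolynomial.aeval_apply_of_eigenvector ((shiftRep h0 w hβ0 δ).comp Z.val)
      (fun i => F (![coord 0, coord 1, coord 3] i)) p 1 (fun i => by
        fin_cases i
        · simp [hF, x, hd, ← Polynomial.aeval_algHom_apply, shiftRep_omega,
            Polynomial.aeval_algebraMap_apply, hw]
        · simpa [hF, x, hβ] using shiftRep_b_pow_one h0 w hβ0 δ l
        · simpa [hF, x] using hd) g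
    rw [hFg, map_zero, LinearMap.zero_apply] at hv
    exact (smul_eq_zero.1 hv.symm).resolve_right one_ne_zero
  · have hr : F.range = (MvPolynomial.aeval x).range := by
      ext z
      simp only [AlgHom.mem_range]
      constructor
      · rintro ⟨f, rfl⟩
        obtain ⟨f, rfl⟩ := Ideal.Quotient.mk_surjective f
        exact ⟨f, rfl⟩
      · rintro ⟨f, rfl⟩
        exact ⟨Ideal.Quotient.mk _ f, rfl⟩
    rw [AlgHom.range_comp, hr, ← Algebra.adjoin_range_eq_range_aeval, AlgHom.map_adjoin,
      ← Set.range_comp]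
    congr 1
    ext z
    simp [x, Fin.exists_fin_succ, eq_comm]
  · rintro _ ⟨f, rfl⟩
    exact (F f).2
end
end

section
/- In the ℂ-algebra U_ε ⊗ U_ε the following identity holds: K^{-l} ⊗ K^{-l} = (ε - ε^{-1})^{2l} ((K^{-1}E) ⊗ K^{-1})^l (1 ⊗ F^l) + ((K^{-1} ⊗ 1) - ε(ε - ε^{-1})^2 (K^{-1}E) ⊗ F)^l (1 ⊗ K^{-l}). -/
noncomputable section

open scoped TensorProduct

abbrev Kq : Type := RatFunc ℂ

/-- The indeterminate `q`. -/
noncomputable def qv : Kq := RatFunc.X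

/-- Generators `E`, `F`, `K`, `K⁻¹` of the quantum group `U_q(sl(2))`. -/
inductive UGen : Type
  | E | F | K | Kinv

/-- The defining relations of `U_q(sl(2))`. -/
inductive URel : FreeAlgebra Kq UGen → FreeAlgebra Kq UGen → Prop
  | KKinv : URel (FreeAlgebra.ι Kq UGen.K * FreeAlgebra.ι Kq UGen.Kinv) 1
  | KinvK : URel (FreeAlgebra.ι Kq UGen.Kinv * FreeAlgebra.ι Kq UGen.K) 1
  | KE : URel (FreeAlgebra.ι Kq UGen.K * FreeAlgebra.ι Kq UGen.E * FreeAlgebra.ι Kq UGen.Kinv)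
      ((qv ^ 2) • FreeAlgebra.ι Kq UGen.E)
  | KF : URel (FreeAlgebra.ι Kq UGen.K * FreeAlgebra.ι Kq UGen.F * FreeAlgebra.ι Kq UGen.Kinv)
      ((qv⁻¹ ^ 2) • FreeAlgebra.ι Kq UGen.F)
  | EF : URel (FreeAlgebra.ι Kq UGen.E * FreeAlgebra.ι Kq UGen.F
        - FreeAlgebra.ι Kq UGen.F * FreeAlgebra.ι Kq UGen.E)
      (((qv - qv⁻¹)⁻¹) • (FreeAlgebra.ι Kq UGen.K - FreeAlgebra.ι Kq UGen.Kinv))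

/-- The quantum group `U_q = U_q(sl(2))`, presented by generators and relations. -/
abbrev Uq : Type := RingQuot URel

noncomputable def Eel : Uq := RingQuot.mkAlgHom Kq URel (FreeAlgebra.ι Kq UGen.E)
noncomputable def Fel : Uq := RingQuot.mkAlgHom Kq URel (FreeAlgebra.ι Kq UGen.F)
noncomputable def Kel : Uq := RingQuot.mkAlgHom Kq URel (FreeAlgebra.ι Kq UGen.K)
noncomputable def Kinvel : Uq := RingQuot.mkAlgHom Kq URel (FreeAlgebra.ι Kq UGen.Kinv)

noncomputable instance : Algebra ℂ Uq :=
  RingHom.toAlgebra' ((algebraMap Kq Uq).comp (algebraMap ℂ Kq))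
    (fun c x => Algebra.commutes (algebraMap ℂ Kq c) x)

/-- The generating set of the integral form `U_A`: as a `ℂ`-algebra, `U_A ⊆ U_q` is
generated by `q, q⁻¹, E, F, K, K⁻¹` and `(K - K⁻¹)/(q - q⁻¹)`. -/
noncomputable def UAset : Set Uq :=
  {algebraMap Kq Uq qv, algebraMap Kq Uq qv⁻¹, Eel, Fel, Kel, Kinvel,
    ((qv - qv⁻¹)⁻¹) • (Kel - Kinvel)}

/-- The integral form `U_A ⊆ U_q`: the `A = ℂ[q, q⁻¹]`-subalgebra of `U_q` generated by
`E, F, K^{±1}` and `(K - K⁻¹)/(q - q⁻¹)`. -/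
noncomputable def UA : Subalgebra ℂ Uq := Algebra.adjoin ℂ UAset

/-- The element `q` of `U_A`. -/
noncomputable def qUA : ↥UA :=
  ⟨algebraMap Kq Uq qv, Algebra.subset_adjoin (by simp [UAset])⟩

noncomputable def EUA : ↥UA := ⟨Eel, Algebra.subset_adjoin (by simp [UAset])⟩
noncomputable def FUA : ↥UA := ⟨Fel, Algebra.subset_adjoin (by simp [UAset])⟩
noncomputable def KUA : ↥UA := ⟨Kel, Algebra.subset_adjoin (by simp [UAset])⟩
noncomputable def KinvUA : ↥UA := ⟨Kinvel, Algebra.subset_adjoin (by simp [UAset])⟩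

/-- The relation defining the unrestricted specialization `U_ε = U_A/(q - ε)U_A`. -/
def UeRel (ε : ℂ) : ↥UA → ↥UA → Prop := fun u v => u = qUA - ε • 1 ∧ v = 0

/-- The unrestricted specialization `U_ε = U_ε(sl(2)) = U_A/(q - ε)U_A`. -/
abbrev Ue (ε : ℂ) : Type := RingQuot (UeRel ε)

/-- The specialization map `ev_ε : U_A → U_ε`. -/
noncomputable def evε (ε : ℂ) : ↥UA →ₐ[ℂ] Ue ε := RingQuot.mkAlgHom ℂ (UeRel ε)

noncomputable def Eε (ε : ℂ) : Ue ε := evε ε EUA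
noncomputable def Fε (ε : ℂ) : Ue ε := evε ε FUA
noncomputable def Kε (ε : ℂ) : Ue ε := evε ε KUA
noncomputable def Kinvε (ε : ℂ) : Ue ε := evε ε KinvUA

/-- `x = -(ε - ε⁻¹)^l E^l K^{-l}`. -/
noncomputable def xε (ε : ℂ) (l : ℕ) : Ue ε :=
  (-((ε - ε⁻¹) ^ l)) • (Eε ε ^ l * Kinvε ε ^ l)

/-- `y = (ε - ε⁻¹)^l F^l`. -/
noncomputable def yε (ε : ℂ) (l : ℕ) : Ue ε := ((ε - ε⁻¹) ^ l) • Fε ε ^ l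

/-- `z = K^l`. -/
noncomputable def zε (ε : ℂ) (l : ℕ) : Ue ε := Kε ε ^ l

/-- `z⁻¹ = K^{-l}`. -/
noncomputable def zinvε (ε : ℂ) (l : ℕ) : Ue ε := Kinvε ε ^ l

/-- The Casimir element `Ω = εK + ε⁻¹K⁻¹ + (ε - ε⁻¹)² F E` of `U_ε`. -/
noncomputable def Ωε (ε : ℂ) : Ue ε :=
  ε • Kε ε + ε⁻¹ • Kinvε ε + ((ε - ε⁻¹) ^ 2) • (Fε ε * Eε ε)

/-- `Z_0(U_ε)`, the subalgebra generated by `E^l`, `F^l` and `K^{±l}`. -/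
noncomputable def Z0 (ε : ℂ) (l : ℕ) : Subalgebra ℂ (Ue ε) :=
  Algebra.adjoin ℂ ({Eε ε ^ l, Fε ε ^ l, Kε ε ^ l, Kinvε ε ^ l} : Set (Ue ε))

noncomputable instance (ε : ℂ) : Ring (Ue ε) := RingQuot.instRing (UeRel ε)

/-- The Gaussian binomial coefficient with parameter `ω`, via the `q`-Pascal recursion. -/
def gaussBinom {R : Type*} [CommRing R] (ω : R) : ℕ → ℕ → R
  | _, 0 => 1
  | 0, _ + 1 => 0
  | n + 1, k + 1 => gaussBinom ω n k + ω ^ (k + 1) * gaussBinom ω n (k + 1)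

section GaussBinom

variable {R : Type*} [CommRing R] (ω : R)

@[simp]
theorem gaussBinom_zero_right (n : ℕ) : gaussBinom ω n 0 = 1 := by
  cases n <;> simp [gaussBinom]

theorem gaussBinom_succ_succ (n k : ℕ) :
    gaussBinom ω (n + 1) (k + 1) = gaussBinom ω n k + ω ^ (k + 1) * gaussBinom ω n (k + 1) := by
  simp [gaussBinom]

theorem gaussBinom_eq_zero_of_lt {n k : ℕ} (h : n < k) : gaussBinom ω n k = 0 := by
  induction n generalizing k with
  | zero =>
    obtain ⟨k, rfl⟩ := Nat.exists_eq_succ_of_ne_zero h.ne'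
    simp [gaussBinom]
  | succ n ih =>
    obtain ⟨k, rfl⟩ := Nat.exists_eq_succ_of_ne_zero (Nat.ne_zero_of_lt h)
    simp only [Nat.succ_eq_add_one, gaussBinom_succ_succ]
    rw [ih (by omega), ih (by omega), mul_zero, add_zero]

@[simp]
theorem gaussBinom_self (n : ℕ) : gaussBinom ω n n = 1 := by
  induction n with
  | zero => simp
  | succ n ih => rw [gaussBinom_succ_succ, ih, gaussBinom_eq_zero_of_lt ω n.lt_succ_self]; simp

theorem sub_one_mul_gaussBinom_succ_succ (n k : ℕ) :
    (ω ^ (k + 1) - 1) * gaussBinom ω (n + 1) (k + 1) = (ω ^ (n + 1) - 1) * gaussBinom ω n k := by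
  induction n generalizing k with
  | zero =>
    cases k with
    | zero => simp
    | succ k => simp [gaussBinom_eq_zero_of_lt]
  | succ m ih =>
    rw [gaussBinom_succ_succ]
    cases k with
    | zero =>
      have h := ih 0
      simp only [gaussBinom_zero_right] at h ⊢
      linear_combination ω ^ (0 + 1) * h
    | succ j =>
      have h₁ := ih j
      have h₂ := ih (j + 1)
      have h₃ := gaussBinom_succ_succ ω m j
      linear_combination ω ^ (j + 2) * h₂ + ω * h₁ - ω * (ω ^ (m + 1) - 1) * h₃

/-- Gaussian binomial coefficients at a root of unity vanish strictly inside the row. -/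
theorem IsPrimitiveRoot.gaussBinom_eq_zero [IsDomain R] {ω : R} {l k : ℕ}
    (hω : IsPrimitiveRoot ω l) (hk : k ≠ 0) (hkl : k < l) : gaussBinom ω l k = 0 := by
  obtain ⟨k, rfl⟩ := Nat.exists_eq_succ_of_ne_zero hk
  obtain ⟨l, rfl⟩ := Nat.exists_eq_succ_of_ne_zero (Nat.ne_zero_of_lt hkl)
  have h := sub_one_mul_gaussBinom_succ_succ ω l k
  rw [show ω ^ (l + 1) = 1 from hω.pow_eq_one, sub_self, zero_mul] at h
  exact (mul_eq_zero.mp h).resolve_left (sub_ne_zero.mpr (hω.pow_ne_one_of_pos_of_lt hk hkl))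

variable {ω} {S : Type*} [Semiring S] [Algebra R S] {a b : S}

theorem mul_pow_of_mul_eq_smul_mul (h : b * a = ω • (a * b)) (k : ℕ) :
    b * a ^ k = ω ^ k • (a ^ k * b) := by
  induction k with
  | zero => simp
  | succ k ih =>
    rw [pow_succ, ← mul_assoc, ih, smul_mul_assoc, mul_assoc, h, mul_smul_comm, smul_smul,
      ← mul_assoc, ← pow_succ]

/-- The `q`-binomial theorem. -/
theorem add_pow_of_mul_eq_smul_mul (h : b * a = ω • (a * b)) (n : ℕ) :
    (a + b) ^ n = ∑ k ∈ Finset.range (n + 1), gaussBinom ω n k • (a ^ k * b ^ (n - k)) := by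
  induction n with
  | zero => simp
  | succ n ih =>
    have hb : ∀ k ∈ Finset.range (n + 1), b * (gaussBinom ω n k • (a ^ k * b ^ (n - k))) =
        (ω ^ k * gaussBinom ω n k) • (a ^ k * b ^ (n + 1 - k)) := fun k hk ↦ by
      rw [Nat.succ_sub (Finset.mem_range_succ_iff.mp hk), pow_succ', mul_smul_comm, ← mul_assoc,
        mul_pow_of_mul_eq_smul_mul h, smul_mul_assoc, smul_smul, mul_assoc, mul_comm]
    rw [pow_succ', ih, add_mul, Finset.mul_sum, Finset.mul_sum, Finset.sum_congr rfl hb,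
      Finset.sum_range_succ' _ (n + 1)]
    have hext : ∑ k ∈ Finset.range (n + 1),
          (ω ^ k * gaussBinom ω n k) • (a ^ k * b ^ (n + 1 - k)) =
        ∑ k ∈ Finset.range (n + 2), (ω ^ k * gaussBinom ω n k) • (a ^ k * b ^ (n + 1 - k)) := by
      rw [Finset.sum_range_succ _ (n + 1), gaussBinom_eq_zero_of_lt ω n.lt_succ_self]
      simp
    rw [hext, Finset.sum_range_succ' _ (n + 1), ← add_assoc, ← Finset.sum_add_distrib]
    congr 1
    · refine Finset.sum_congr rfl fun k _ ↦ ?_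
      rw [gaussBinom_succ_succ, add_smul, Nat.succ_sub_succ, pow_succ' a, mul_assoc, mul_smul_comm]
    · simp

/-- The Frobenius identity for `q`-commuting elements at a primitive root of unity. -/
theorem IsPrimitiveRoot.add_pow_of_mul_eq_smul_mul [IsDomain R] {l : ℕ}
    (hω : IsPrimitiveRoot ω l) (hl : l ≠ 0) (h : b * a = ω • (a * b)) :
    (a + b) ^ l = a ^ l + b ^ l := by
  obtain ⟨l, rfl⟩ := Nat.exists_eq_succ_of_ne_zero hl
  rw [_root_.add_pow_of_mul_eq_smul_mul h, Finset.sum_range_succ, Finset.sum_range_succ',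
    Finset.sum_eq_zero fun k hk ↦ ?_]
  · simp [add_comm]
  · rw [hω.gaussBinom_eq_zero k.succ_ne_zero (by simpa using hk), zero_smul]

end GaussBinom

theorem Kinvel_mul_Kel : Kinvel * Kel = 1 := by
  simpa [Kinvel, Kel] using RingQuot.mkAlgHom_rel Kq URel.KinvK

theorem Eel_mul_Kinvel : Eel * Kinvel = qv ^ 2 • (Kinvel * Eel) := by
  have h : Kel * Eel * Kinvel = qv ^ 2 • Eel := by
    simpa [Kinvel, Kel, Eel] using RingQuot.mkAlgHom_rel Kq URel.KE
  rw [← mul_smul_comm, ← h, ← mul_assoc, ← mul_assoc, Kinvel_mul_Kel, one_mul]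

theorem Kinvel_mul_Fel : Kinvel * Fel = qv ^ 2 • (Fel * Kinvel) := by
  have h : Kel * Fel * Kinvel = qv⁻¹ ^ 2 • Fel := by
    simpa [Kinvel, Kel, Fel] using RingQuot.mkAlgHom_rel Kq URel.KF
  have hF : Fel * Kinvel = qv⁻¹ ^ 2 • (Kinvel * Fel) := by
    rw [← mul_smul_comm, ← h, ← mul_assoc, ← mul_assoc, Kinvel_mul_Kel, one_mul]
  have hq : qv ≠ 0 := RatFunc.X_ne_zero
  rw [hF, smul_smul, ← mul_pow, mul_inv_cancel₀ hq, one_pow, one_smul]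

theorem EUA_mul_KinvUA : EUA * KinvUA = qUA ^ 2 * (KinvUA * EUA) := by
  refine Subtype.ext (Eel_mul_Kinvel.trans ?_)
  rw [Algebra.smul_def, map_pow]
  rfl

theorem KinvUA_mul_FUA : KinvUA * FUA = qUA ^ 2 * (FUA * KinvUA) := by
  refine Subtype.ext (Kinvel_mul_Fel.trans ?_)
  rw [Algebra.smul_def, map_pow]
  rfl

theorem evε_qUA (ε : ℂ) : evε ε qUA = algebraMap ℂ (Ue ε) ε := by
  have h : evε ε (qUA - ε • 1) = evε ε 0 :=
    RingQuot.mkAlgHom_rel ℂ (show UeRel ε (qUA - ε • 1) 0 from ⟨rfl, rfl⟩)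
  have hq : qUA = (qUA - ε • 1) + ε • 1 :=
    Subtype.ext (sub_add_cancel (qUA : Uq) ((ε • 1 : ↥UA) : Uq)).symm
  rw [hq, map_add, h, map_zero, zero_add, map_smul, map_one, Algebra.algebraMap_eq_smul_one]

theorem Eε_mul_Kinvε (ε : ℂ) : Eε ε * Kinvε ε = ε ^ 2 • (Kinvε ε * Eε ε) := by
  rw [Eε, Kinvε, ← map_mul, EUA_mul_KinvUA, map_mul, map_pow, evε_qUA, ← map_pow, map_mul,
    Algebra.smul_def]

theorem Kinvε_mul_Fε (ε : ℂ) : Kinvε ε * Fε ε = ε ^ 2 • (Fε ε * Kinvε ε) := by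
  rw [Fε, Kinvε, ← map_mul, KinvUA_mul_FUA, map_mul, map_pow, evε_qUA, ← map_pow, map_mul,
    Algebra.smul_def]

theorem tmul_pow_eq_of_mul_eq_smul_mul {A : Type*} [Ring A] [Algebra ℂ A] {e f k : A} {ε : ℂ}
    {l : ℕ} (hodd : Odd l) (hε : IsPrimitiveRoot ε l) (he : e * k = ε ^ 2 • (k * e))
    (hf : k * f = ε ^ 2 • (f * k)) :
    (k ^ l) ⊗ₜ[ℂ] (k ^ l)
      = ((ε - ε⁻¹) ^ (2 * l)) • (((k * e) ⊗ₜ[ℂ] k) ^ l * ((1 : A) ⊗ₜ[ℂ] (f ^ l)))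
        + ((k ⊗ₜ[ℂ] (1 : A)) - (ε * (ε - ε⁻¹) ^ 2) • ((k * e) ⊗ₜ[ℂ] f)) ^ l
          * ((1 : A) ⊗ₜ[ℂ] (k ^ l)) := by
  have hkf : Commute (k ^ l) (f ^ l) := by
    refine Commute.pow_left ?_ l
    rw [Commute, SemiconjBy, mul_pow_of_mul_eq_smul_mul hf, pow_right_comm, hε.pow_eq_one,
      one_pow, one_smul]
  have hω : IsPrimitiveRoot (ε ^ 2) l := hε.pow_of_coprime 2 hodd.coprime_two_left
  have hcomm : (-((ε * (ε - ε⁻¹) ^ 2) • ((k * e) ⊗ₜ[ℂ] f))) *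
      (k ⊗ₜ[ℂ] (1 : A)) =
      ε ^ 2 • ((k ⊗ₜ[ℂ] (1 : A)) *
        (-((ε * (ε - ε⁻¹) ^ 2) • ((k * e) ⊗ₜ[ℂ] f)))) := by
    rw [neg_mul, mul_neg, smul_neg, smul_mul_assoc, mul_smul_comm, smul_comm (ε ^ 2),
      Algebra.TensorProduct.tmul_mul_tmul, Algebra.TensorProduct.tmul_mul_tmul, mul_assoc,
      he, mul_smul_comm, ← TensorProduct.smul_tmul', mul_one, one_mul]
  rw [sub_eq_add_neg (k ⊗ₜ[ℂ] (1 : A)), hω.add_pow_of_mul_eq_smul_mul hodd.pos.ne' hcomm, hodd.neg_pow, smul_pow,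
    mul_pow, hε.pow_eq_one, one_mul, ← pow_mul]
  simp only [Algebra.TensorProduct.tmul_pow, Algebra.TensorProduct.tmul_mul_tmul, add_mul, neg_mul,
    smul_mul_assoc, one_pow, mul_one, one_mul]
  rw [hkf.eq]
  abel

/-- In `U_ε ⊗ U_ε` the following identity holds:
`K^{-l} ⊗ K^{-l} = (ε - ε⁻¹)^{2l} ((K⁻¹E) ⊗ K⁻¹)^l (1 ⊗ F^l)
  + ((K⁻¹ ⊗ 1) - ε(ε - ε⁻¹)² (K⁻¹E) ⊗ F)^l (1 ⊗ K^{-l})`. -/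
theorem statement19 (l : ℕ) (hl : 3 ≤ l) (hodd : Odd l)
    (ε : ℂ) (hε : IsPrimitiveRoot ε l) :
    (Kinvε ε ^ l) ⊗ₜ[ℂ] (Kinvε ε ^ l)
      = ((ε - ε⁻¹) ^ (2 * l)) •
          (((Kinvε ε * Eε ε) ⊗ₜ[ℂ] Kinvε ε) ^ l * ((1 : Ue ε) ⊗ₜ[ℂ] (Fε ε ^ l)))
        + ((Kinvε ε ⊗ₜ[ℂ] (1 : Ue ε))
            - (ε * (ε - ε⁻¹) ^ 2) • ((Kinvε ε * Eε ε) ⊗ₜ[ℂ] Fε ε)) ^ l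
          * ((1 : Ue ε) ⊗ₜ[ℂ] (Kinvε ε ^ l)) := by
  exact tmul_pow_eq_of_mul_eq_smul_mul hodd hε (Eε_mul_Kinvε ε) (Kinvε_mul_Fε ε)
end
end
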